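/- Let A be a real l×m matrix satisfying the RIP of order 2s with constant δ₂ₛ ∈ (0,1) and the RIP of order 3s with constant δ₃ₛ ∈ (0,1). Let h⋆ ∈ ℝᵐ have at most s nonzero entries, set y = A h⋆, and let h ∈ ℝᵐ have at most s nonzero entries. Let S be a set of s largest-magnitude indices of the proxy h + Aᵀ(y − A h), and let ĥ be a minimizer of ‖y − A u‖₂ over all u ∈ ℝᵐ with support contained in S. Then ‖ĥ − h⋆‖₂ ≤ √(2 δ₃ₛ² / (1 − δ₂ₛ²)) · ‖h − h⋆‖₂. -/

import Mathlib

open Matrix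
open scoped BigOperators

/-- The Euclidean (ℓ₂) norm of a vector in ℝⁿ. -/
noncomputable def l2norm {n : ℕ} (x : Fin n → ℝ) : ℝ := Real.sqrt (∑ i, (x i)^2)

/-- A vector has at most `s` nonzero entries. -/
def IsSparse {m : ℕ} (s : ℕ) (x : Fin m → ℝ) : Prop :=
  (Finset.univ.filter fun i => x i ≠ 0).card ≤ s

/-- `A` satisfies the restricted isometry property of order `k` with constant `δ`. -/
def SatisfiesRIP {l m : ℕ} (A : Matrix (Fin l) (Fin m) ℝ) (k : ℕ) (δ : ℝ) : Prop :=
  ∀ x : Fin m → ℝ, IsSparse k x →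
    (1 - δ) * (l2norm x)^2 ≤ (l2norm (A *ᵥ x))^2 ∧
      (l2norm (A *ᵥ x))^2 ≤ (1 + δ) * (l2norm x)^2

/-- `S` is a set of `s` largest-magnitude indices of `h`. -/
def IsLargestIndices {m : ℕ} (s : ℕ) (h : Fin m → ℝ) (S : Finset (Fin m)) : Prop :=
  S.card = s ∧ ∀ i ∈ S, ∀ j ∉ S, |h j| ≤ |h i|

/-- The restriction of `v` to `S`: equal to `v` on `S` and zero outside `S`. -/
def restrictVec {m : ℕ} (S : Finset (Fin m)) (v : Fin m → ℝ) : Fin m → ℝ :=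
  fun i => if i ∈ S then v i else 0

/-- `hhat` minimizes `‖y − A u‖₂` over all `u` with support contained in `S`. -/
def IsLSMinimizerOn {l m : ℕ} (A : Matrix (Fin l) (Fin m) ℝ) (y : Fin l → ℝ)
    (S : Finset (Fin m)) (hhat : Fin m → ℝ) : Prop :=
  (∀ i, hhat i ≠ 0 → i ∈ S) ∧
  ∀ u : Fin m → ℝ, (∀ i, u i ≠ 0 → i ∈ S) →
    l2norm (y - A *ᵥ hhat) ≤ l2norm (y - A *ᵥ u)

theorem l2norm_sq {n : ℕ} (x : Fin n → ℝ) : l2norm x ^ 2 = x ⬝ᵥ x := by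
  rw [l2norm, Real.sq_sqrt (Finset.sum_nonneg fun i _ => sq_nonneg (x i))]
  simp only [dotProduct, sq]

theorem l2norm_nonneg {n : ℕ} (x : Fin n → ℝ) : 0 ≤ l2norm x :=
  Real.sqrt_nonneg _

theorem dotProduct_restrictVec {m : ℕ} (S : Finset (Fin m)) (v : Fin m → ℝ) :
    v ⬝ᵥ restrictVec S v = ∑ i ∈ S, v i ^ 2 := by
  simp [dotProduct, restrictVec, sq]

theorem restrictVec_dotProduct_self {m : ℕ} (S : Finset (Fin m)) (v : Fin m → ℝ) :
    restrictVec S v ⬝ᵥ restrictVec S v = ∑ i ∈ S, v i ^ 2 := by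
  simp [dotProduct, restrictVec, sq]

theorem mem_of_restrictVec_ne_zero {m : ℕ} {S : Finset (Fin m)} {v : Fin m → ℝ} {i : Fin m}
    (hi : restrictVec S v i ≠ 0) : i ∈ S := by
  by_contra hiS
  exact hi (if_neg hiS)

theorem IsSparse.of_support_subset {m k : ℕ} {x : Fin m → ℝ} {U : Finset (Fin m)}
    (hU : U.card ≤ k) (hx : ∀ i, x i ≠ 0 → i ∈ U) : IsSparse k x :=
  (Finset.card_le_card fun i hi => hx i (Finset.mem_filter.1 hi).2).trans hU

/-- Polarization of the restricted isometry property: `1 - AᵀA` has norm at most `δ` on vectors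
with a common support of size at most `k`. -/
theorem SatisfiesRIP.sq_dotProduct_sub_le {l m k : ℕ} {A : Matrix (Fin l) (Fin m) ℝ} {δ : ℝ}
    (hA : SatisfiesRIP A k δ) {U : Finset (Fin m)} (hU : U.card ≤ k) {u v : Fin m → ℝ}
    (hu : ∀ i, u i ≠ 0 → i ∈ U) (hv : ∀ i, v i ≠ 0 → i ∈ U) :
    (u ⬝ᵥ v - (A *ᵥ u) ⬝ᵥ (A *ᵥ v)) ^ 2 ≤ δ ^ 2 * (u ⬝ᵥ u) * (v ⬝ᵥ v) := by
  have key (t : ℝ) : 0 ≤ δ * (u ⬝ᵥ u) * (t * t)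
      + (-2 * (u ⬝ᵥ v - (A *ᵥ u) ⬝ᵥ (A *ᵥ v))) * t + δ * (v ⬝ᵥ v) := by
    have sparse (c : ℝ) : IsSparse k (t • u + c • v) := by
      refine IsSparse.of_support_subset hU fun i hi => ?_
      by_contra hiU
      have h1 : u i = 0 := by_contra fun h => hiU (hu i h)
      have h2 : v i = 0 := by_contra fun h => hiU (hv i h)
      exact hi (by simp [h1, h2])
    have h1 := (hA _ (sparse 1)).1
    have h2 := (hA _ (sparse (-1))).2
    simp only [l2norm_sq, mulVec_add, mulVec_smul, add_dotProduct, dotProduct_add,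
      smul_dotProduct, dotProduct_smul, smul_eq_mul, dotProduct_comm v u,
      dotProduct_comm (A *ᵥ v) (A *ᵥ u)] at h1 h2
    linarith
  have := discrim_le_zero key
  rw [discrim] at this
  linarith

/-- The residual of a least-squares minimizer is orthogonal to the image of its feasible set. -/
theorem IsLSMinimizerOn.residual_dotProduct_eq_zero {l m : ℕ} {A : Matrix (Fin l) (Fin m) ℝ}
    {y : Fin l → ℝ} {S : Finset (Fin m)} {w : Fin m → ℝ} (hw : IsLSMinimizerOn A y S w)
    {z : Fin m → ℝ} (hz : ∀ i, z i ≠ 0 → i ∈ S) :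
    (y - A *ᵥ w) ⬝ᵥ (A *ᵥ z) = 0 := by
  have key (t : ℝ) : 0 ≤ ((A *ᵥ z) ⬝ᵥ (A *ᵥ z)) * (t * t)
      + (-2 * ((y - A *ᵥ w) ⬝ᵥ (A *ᵥ z))) * t + 0 := by
    have h1 := hw.2 (w + t • z) fun i hi => by
      by_contra hiS
      have h1 : w i = 0 := by_contra fun h => hiS (hw.1 i h)
      have h2 : z i = 0 := by_contra fun h => hiS (hz i h)
      exact hi (by simp [h1, h2])
    have h2 := pow_le_pow_left₀ (l2norm_nonneg _) h1 2
    rw [mulVec_add, mulVec_smul, ← sub_sub, l2norm_sq, l2norm_sq] at h2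
    generalize y - A *ᵥ w = r at h2 ⊢
    simp only [sub_dotProduct, dotProduct_sub, smul_dotProduct, dotProduct_smul, smul_eq_mul,
      dotProduct_comm (A *ᵥ z) r] at h2
    linarith
  have := discrim_le_zero key
  rw [discrim] at this
  nlinarith [sq_nonneg ((y - A *ᵥ w) ⬝ᵥ (A *ᵥ z))]

/-- A set of `s` largest-magnitude indices captures at least as much energy as any set of at most
`s` indices, after removing the common indices. -/
theorem IsLargestIndices.sum_sq_sdiff_le {m s : ℕ} {p : Fin m → ℝ} {S T : Finset (Fin m)}
    (hS : IsLargestIndices s p S) (hT : T.card ≤ s) :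
    ∑ i ∈ T \ S, p i ^ 2 ≤ ∑ i ∈ S \ T, p i ^ 2 := by
  have hcard : (T \ S).card ≤ (S \ T).card :=
    Finset.card_sdiff_le_card_sdiff_iff.2 (hT.trans hS.1.ge)
  rcases (S \ T).eq_empty_or_nonempty with hE | hE
  · rw [hE, Finset.card_empty, Nat.le_zero, Finset.card_eq_zero] at hcard
    rw [hE, hcard]
  · obtain ⟨i₀, hi₀, hmin⟩ := Finset.exists_min_image (S \ T) (fun i => p i ^ 2) hE
    calc ∑ i ∈ T \ S, p i ^ 2 ≤ (T \ S).card • p i₀ ^ 2 :=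
          Finset.sum_le_card_nsmul _ _ _ fun j hj => sq_le_sq.2
            (hS.2 i₀ (Finset.mem_sdiff.1 hi₀).1 j (Finset.mem_sdiff.1 hj).2)
      _ ≤ (S \ T).card • p i₀ ^ 2 := nsmul_le_nsmul_left (sq_nonneg _) hcard
      _ ≤ ∑ i ∈ S \ T, p i ^ 2 := Finset.card_nsmul_le_sum _ _ _ hmin

/-- The least-squares step: the error on `S` is controlled by the total error. -/
theorem IsLSMinimizerOn.sum_sq_error_le {l m s : ℕ} {A : Matrix (Fin l) (Fin m) ℝ} {δ : ℝ}
    (hA : SatisfiesRIP A (2 * s) δ) {x₀ w : Fin m → ℝ} (hx₀ : IsSparse s x₀)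
    {S : Finset (Fin m)} (hS : S.card ≤ s) (hw : IsLSMinimizerOn A (A *ᵥ x₀) S w) :
    ∑ i ∈ S, (w - x₀) i ^ 2 ≤ δ ^ 2 * ((w - x₀) ⬝ᵥ (w - x₀)) := by
  classical
  have hU : (S ∪ Finset.univ.filter fun i => x₀ i ≠ 0).card ≤ 2 * s := by
    have := Finset.card_union_le S (Finset.univ.filter fun i => x₀ i ≠ 0)
    unfold IsSparse at hx₀
    omega
  have hbound := hA.sq_dotProduct_sub_le hU (u := w - x₀) (v := restrictVec S (w - x₀))
    (fun i hi => by
      by_contra hiU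
      simp only [Finset.mem_union, Finset.mem_filter, Finset.mem_univ, true_and, not_or,
        not_not] at hiU
      have h1 : w i = 0 := by_contra fun h => hiU.1 (hw.1 i h)
      exact hi (by simp [h1, hiU.2]))
    (fun i hi => Finset.mem_union_left _ (mem_of_restrictVec_ne_zero hi))
  have horth := hw.residual_dotProduct_eq_zero (z := restrictVec S (w - x₀))
    fun i hi => mem_of_restrictVec_ne_zero hi
  rw [← neg_sub, ← mulVec_sub, neg_dotProduct, neg_eq_zero] at horth
  rw [horth, sub_zero, dotProduct_restrictVec, restrictVec_dotProduct_self, sq] at hbound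
  rcases (Finset.sum_nonneg fun i (_ : i ∈ S) => sq_nonneg ((w - x₀) i)).eq_or_lt with h0 | h0
  · rw [← h0, ← l2norm_sq]
    positivity
  · exact le_of_mul_le_mul_right hbound h0

/-- The error of the proxy `h + Aᵀ(A x₀ - A h)` on `T` is controlled by the error of `h`. -/
theorem SatisfiesRIP.sum_sq_proxy_error_le {l m k : ℕ} {A : Matrix (Fin l) (Fin m) ℝ} {δ : ℝ}
    (hA : SatisfiesRIP A k δ) {U T : Finset (Fin m)} (hU : U.card ≤ k) (hTU : T ⊆ U)
    {x₀ h : Fin m → ℝ} (hh : ∀ i, (h - x₀) i ≠ 0 → i ∈ U) :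
    ∑ i ∈ T, (h + Aᵀ *ᵥ (A *ᵥ x₀ - A *ᵥ h) - x₀) i ^ 2
      ≤ δ ^ 2 * ((h - x₀) ⬝ᵥ (h - x₀)) := by
  set e := h + Aᵀ *ᵥ (A *ᵥ x₀ - A *ᵥ h) - x₀ with he
  have hbound := hA.sq_dotProduct_sub_le hU (v := restrictVec T e) hh
    fun i hi => hTU (mem_of_restrictVec_ne_zero hi)
  have he' : e = (h - x₀) - Aᵀ *ᵥ (A *ᵥ (h - x₀)) := by
    rw [he, mulVec_sub A, ← neg_sub (A *ᵥ h), mulVec_neg]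
    abel
  have hdot : (h - x₀) ⬝ᵥ restrictVec T e - (A *ᵥ (h - x₀)) ⬝ᵥ (A *ᵥ restrictVec T e)
      = ∑ i ∈ T, e i ^ 2 := by
    rw [← dotProduct_restrictVec, dotProduct_mulVec, ← mulVec_transpose, ← sub_dotProduct, ← he']
  rw [hdot, restrictVec_dotProduct_self, sq] at hbound
  rcases (Finset.sum_nonneg fun i (_ : i ∈ T) => sq_nonneg (e i)).eq_or_lt with h0 | h0
  · rw [← h0, ← l2norm_sq]
    positivity
  · exact le_of_mul_le_mul_right hbound h0

/-- Per-node contraction of the noiseless greedy step (Theorem 3.5 of Foucart, adapted). -/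
theorem greedy_step_contraction
    (l m s : ℕ) (A : Matrix (Fin l) (Fin m) ℝ) (δ₂ δ₃ : ℝ)
    (hδ₂0 : 0 < δ₂) (hδ₂1 : δ₂ < 1) (hδ₃0 : 0 < δ₃) (hδ₃1 : δ₃ < 1)
    (hRIP2 : SatisfiesRIP A (2*s) δ₂) (hRIP3 : SatisfiesRIP A (3*s) δ₃)
    (hstar : Fin m → ℝ) (hstar_sparse : IsSparse s hstar)
    (y : Fin l → ℝ) (hy : y = A *ᵥ hstar)
    (h : Fin m → ℝ) (hh_sparse : IsSparse s h)
    (S : Finset (Fin m)) (hS : IsLargestIndices s (h + Aᵀ *ᵥ (y - A *ᵥ h)) S)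
    (hhat : Fin m → ℝ) (hhat_min : IsLSMinimizerOn A y S hhat) :
    l2norm (hhat - hstar) ≤
      Real.sqrt (2 * δ₃^2 / (1 - δ₂^2)) * l2norm (h - hstar) := by
  classical
  subst hy
  set T := Finset.univ.filter fun i => hstar i ≠ 0 with hT
  set H := Finset.univ.filter fun i => h i ≠ 0 with hH
  set p := h + Aᵀ *ᵥ (A *ᵥ hstar - A *ᵥ h) with hp
  have hTcard : T.card ≤ s := hstar_sparse
  have hHcard : H.card ≤ s := hh_sparse
  have hT0 (i : Fin m) (hi : i ∉ T) : hstar i = 0 := by simpa [hT] using hi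
  have hH0 (i : Fin m) (hi : i ∉ H) : h i = 0 := by simpa [hH] using hi
  have hon := hhat_min.sum_sq_error_le hRIP2 hstar_sparse hS.1.le
  have hU : (H ∪ (T ∪ S)).card ≤ 3 * s := by
    have h1 := Finset.card_union_le H (T ∪ S)
    have h2 := Finset.card_union_le T S
    have h3 := hS.1
    omega
  have hproxy := hRIP3.sum_sq_proxy_error_le (T := T \ S ∪ S \ T) (x₀ := hstar) (h := h) hU
    (fun i hi => by
      simp only [Finset.mem_union, Finset.mem_sdiff] at hi ⊢
      tauto)
    (fun i hi => by
      by_contra hiU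
      simp only [Finset.mem_union, not_or] at hiU
      exact hi (by simp [hH0 i hiU.1, hT0 i hiU.2.1]))
  rw [← hp, Finset.sum_union disjoint_sdiff_sdiff] at hproxy
  have hE : ∑ i ∈ S \ T, (p - hstar) i ^ 2 = ∑ i ∈ S \ T, p i ^ 2 :=
    Finset.sum_congr rfl fun i hi => by
      rw [Pi.sub_apply, hT0 i (Finset.mem_sdiff.1 hi).2, sub_zero]
  have hlarge := hS.sum_sq_sdiff_le hTcard
  have hoff : ∑ i ∈ Sᶜ, (hhat - hstar) i ^ 2 = ∑ i ∈ T \ S, hstar i ^ 2 := by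
    have hhat0 (i : Fin m) (hi : i ∉ S) : hhat i = 0 := by_contra fun h => hi (hhat_min.1 i h)
    calc ∑ i ∈ Sᶜ, (hhat - hstar) i ^ 2 = ∑ i ∈ Sᶜ, hstar i ^ 2 :=
          Finset.sum_congr rfl fun i hi => by
            rw [Pi.sub_apply, hhat0 i (Finset.mem_compl.1 hi), zero_sub, neg_sq]
      _ = ∑ i ∈ T \ S, hstar i ^ 2 := by
          symm
          refine Finset.sum_subset (fun i hi => Finset.mem_compl.2 (Finset.mem_sdiff.1 hi).2) ?_
          intro i hi hi'
          rw [hT0 i fun hiT => hi' (Finset.mem_sdiff.2 ⟨hiT, Finset.mem_compl.1 hi⟩)]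
          norm_num
  have hsplit : ∑ i ∈ T \ S, hstar i ^ 2
      ≤ 2 * ∑ i ∈ T \ S, p i ^ 2 + 2 * ∑ i ∈ T \ S, (p - hstar) i ^ 2 := by
    rw [Finset.mul_sum, Finset.mul_sum, ← Finset.sum_add_distrib]
    refine Finset.sum_le_sum fun i _ => ?_
    rw [Pi.sub_apply]
    nlinarith [sq_nonneg (2 * p i - hstar i)]
  have htotal : (hhat - hstar) ⬝ᵥ (hhat - hstar)
      = ∑ i ∈ S, (hhat - hstar) i ^ 2 + ∑ i ∈ Sᶜ, (hhat - hstar) i ^ 2 := by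
    rw [Finset.sum_add_sum_compl]
    simp only [dotProduct, sq]
  have hpos : 0 < 1 - δ₂ ^ 2 := by nlinarith
  rw [← l2norm_sq] at hon hproxy htotal
  refine (sq_le_sq₀ (l2norm_nonneg _)
    (mul_nonneg (Real.sqrt_nonneg _) (l2norm_nonneg _))).1 ?_
  rw [mul_pow, Real.sq_sqrt (by positivity), div_mul_eq_mul_div, le_div_iff₀ hpos]
  linarith
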